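/- Let V be a 7-dimensional real vector space, B a nondegenerate symmetric bilinear form on V, and × a cross product on (V, B). If T : V → V is a bijective linear map satisfying T(x × y) = T(x) × T(y) for all x, y ∈ V (i.e. an automorphism of the cross product), then T is an isometry of B: B(T(x), T(y)) = B(x, y) for all x, y ∈ V. -/

import Mathlib

section CrossProduct

variable {V : Type*} [AddCommGroup V] [Module ℝ V]
  {B : V →ₗ[ℝ] V →ₗ[ℝ] ℝ} {cross : V →ₗ[ℝ] V →ₗ[ℝ] V}

/-- The trilinear form `B (x × y) z` is skew in its last two arguments. -/
theorem cross_apply_swap (hskew : ∀ x y, cross x y = - cross y x)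
    (horth : ∀ x y, B (cross x y) x = 0) (x y z : V) :
    B (cross x y) z = - B (cross x z) y := by
  have h (w : V) : B (cross x w) w = 0 := by
    rw [hskew, map_neg, LinearMap.neg_apply, horth, neg_zero]
  have hyz := h (y + z)
  simp only [map_add, LinearMap.add_apply, h] at hyz
  linarith

/-- The polarization of the norm identity for a cross product in its second argument. -/
theorem apply_cross_cross (hsymm : ∀ x y, B x y = B y x)
    (hcomp : ∀ x y, B (cross x y) (cross x y) = B x x * B y y - (B x y) ^ 2) (x y z : V) :
    B (cross x y) (cross x z) = B x x * B y z - B x y * B x z := by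
  have hyz := hcomp x (y + z)
  simp only [map_add, LinearMap.add_apply] at hyz
  have hy := hcomp x y
  have hz := hcomp x z
  rw [hsymm (cross x z) (cross x y), hsymm z y] at hyz
  linarith

theorem cross_cross_self (hsymm : ∀ x y, B x y = B y x)
    (hnd : ∀ x, (∀ y, B x y = 0) → x = 0)
    (hskew : ∀ x y, cross x y = - cross y x)
    (horth : ∀ x y, B (cross x y) x = 0)
    (hcomp : ∀ x y, B (cross x y) (cross x y) = B x x * B y y - (B x y) ^ 2) (x y : V) :
    cross x (cross x y) = B x y • x - B x x • y := by
  rw [← sub_eq_zero]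
  refine hnd _ fun z => ?_
  have h := cross_apply_swap hskew horth x (cross x y) z
  rw [hsymm (cross x z), apply_cross_cross hsymm hcomp] at h
  simp only [map_sub, map_smul, LinearMap.sub_apply, LinearMap.smul_apply, smul_eq_mul, h]
  ring

end CrossProduct

/-- In dimension 7, every automorphism of a cross product is an isometry of the induced
bilinear form. -/
theorem stmt_11 (V : Type*) [AddCommGroup V] [Module ℝ V] [FiniteDimensional ℝ V]
    (hdim : Module.finrank ℝ V = 7)
    (B : V →ₗ[ℝ] V →ₗ[ℝ] ℝ) (cross : V →ₗ[ℝ] V →ₗ[ℝ] V)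
    (hsymm : ∀ x y, B x y = B y x)
    (hnd : ∀ x, (∀ y, B x y = 0) → x = 0)
    (hskew : ∀ x y, cross x y = - cross y x)
    (horth : ∀ x y, B (cross x y) x = 0)
    (hcomp : ∀ x y, B (cross x y) (cross x y) = B x x * B y y - (B x y) ^ 2)
    (T : V →ₗ[ℝ] V) (hTbij : Function.Bijective T)
    (hTaut : ∀ x y, T (cross x y) = cross (T x) (T y)) :
    ∀ x y, B (T x) (T y) = B x y := by
  have hnorm (x : V) : B (T x) (T x) = B x x := by
    obtain ⟨y, hy⟩ : ∃ y, y ∉ Submodule.span ℝ {x} := by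
      by_contra! h
      have h1 := finrank_span_le_card (R := ℝ) ({x} : Set V)
      rw [(Submodule.eq_top_iff'.2 h), finrank_top, hdim] at h1
      simp at h1
    have h := congrArg T (cross_cross_self hsymm hnd hskew horth hcomp x y)
    rw [hTaut, hTaut, cross_cross_self hsymm hnd hskew horth hcomp, ← map_smul, ← map_smul,
      ← map_sub] at h
    have hxy := hTbij.injective h
    by_contra hne
    refine hy (((Submodule.span ℝ {x}).smul_mem_iff (sub_ne_zero.2 hne)).1 ?_)
    refine Submodule.mem_span_singleton.2 ⟨B (T x) (T y) - B x y, ?_⟩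
    linear_combination (norm := module) hxy
  intro x y
  have hxy := hnorm (x + y)
  simp only [map_add, LinearMap.add_apply, hnorm] at hxy
  rw [hsymm (T y) (T x), hsymm y x] at hxy
  linarith
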